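/- Let d ≥ 1 be an integer and α ∈ (0,2) with 2−α < d, let φ_α(y) = (1−|y|²)_+^{α/2}, and let K_{α,d} = Γ(d/2)/(2^α Γ(1+α/2) Γ((d+α)/2)). Then for every y ∈ ℝ^d with |y| < 1, the function I_{2−α}(φ_α) is differentiable at y and ∇(I_{2−α}(φ_α))(y) = −(1/(d·K_{α,d})) y. -/

import Mathlib

open Real MeasureTheory

/-- The Riesz potential `I_β(u)(x)` on `ℝ^d`. -/
noncomputable def rieszPotential (d : ℕ) (β : ℝ)
    (u : EuclideanSpace ℝ (Fin d) → ℝ) (x : EuclideanSpace ℝ (Fin d)) : ℝ :=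
  (Real.Gamma (((d : ℝ) - β) / 2) /
      (2 ^ β * Real.pi ^ ((d : ℝ) / 2) * Real.Gamma (β / 2))) *
    ∫ z : EuclideanSpace ℝ (Fin d), u z * ‖x - z‖ ^ (β - (d : ℝ))

section Potential

open Set Metric Measure
open scoped ENNReal

theorem lintegral_eq_lintegral_toSphere {E : Type*} [NormedAddCommGroup E] [NormedSpace ℝ E]
    [MeasurableSpace E] [BorelSpace E] [FiniteDimensional ℝ E] [Nontrivial E]
    (μ : Measure E) [μ.IsAddHaarMeasure] {g : E → ℝ≥0∞} (hg : Measurable g) :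
    ∫⁻ w, g w ∂μ = ∫⁻ ω : sphere (0 : E) 1, (∫⁻ r in Ioi (0 : ℝ),
      ENNReal.ofReal (r ^ (Module.finrank ℝ E - 1)) * g (r • ω.1)) ∂μ.toSphere := by
  calc
    ∫⁻ w, g w ∂μ = ∫⁻ w : ({(0)}ᶜ : Set E), g w.1 ∂(μ.comap (↑)) := by
      rw [lintegral_subtype_comap (measurableSet_singleton _).compl, restrict_compl_singleton]
    _ = ∫⁻ q, g (q.2.1 • q.1.1) ∂μ.toSphere.prod (.volumeIoiPow (Module.finrank ℝ E - 1)) := by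
      rw [← μ.measurePreserving_homeomorphUnitSphereProd.lintegral_comp_emb
        (Homeomorph.measurableEmbedding _)]
      refine lintegral_congr fun w ↦ ?_
      have hw : (‖w.1‖ : ℝ) ≠ 0 := norm_ne_zero_iff.2 w.2
      simp [smul_smul, hw]
    _ = _ := by
      rw [lintegral_prod _ (by fun_prop)]
      refine lintegral_congr fun ω ↦ ?_
      rw [Measure.volumeIoiPow, lintegral_withDensity_eq_lintegral_mul _ (by fun_prop)
        (by fun_prop)]
      simp only [Pi.mul_apply]
      rw [lintegral_subtype_comap measurableSet_Ioi (f := fun r : ℝ ↦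
        ENNReal.ofReal (r ^ (Module.finrank ℝ E - 1)) * g (r • ω.1))]

theorem lintegral_ofReal_Ioo_pow {a : ℝ} (ha : 0 ≤ a) (n : ℕ) :
    ∫⁻ r in Ioo 0 a, ENNReal.ofReal (r ^ n) = ENNReal.ofReal (a ^ (n + 1) / (n + 1)) := by
  rw [restrict_congr_set Ioo_ae_eq_Ioc,
    ← ofReal_integral_eq_lintegral_ofReal (intervalIntegral.intervalIntegrable_pow _).1,
    ← intervalIntegral.integral_of_le ha]
  · simp
  · filter_upwards [ae_restrict_mem measurableSet_Ioc] with y hy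
    exact pow_nonneg hy.1.le _

theorem lintegral_rpow_mul_exp_neg_mul {a r : ℝ} (ha : 0 < a) (hr : 0 < r) :
    ∫⁻ y in Ioi (0 : ℝ), ENNReal.ofReal (y ^ (a - 1) * Real.exp (-(r * y))) =
      ENNReal.ofReal ((1 / r) ^ a * Real.Gamma a) := by
  have h := Real.integral_rpow_mul_exp_neg_mul_Ioi ha hr
  have hpos : 0 < (1 / r) ^ a * Real.Gamma a := by
    have := Real.Gamma_pos_of_pos ha
    positivity
  rw [← h, ofReal_integral_eq_lintegral_ofReal]
  · exact Integrable.of_integral_ne_zero (by rw [h]; exact hpos.ne')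
  · filter_upwards [ae_restrict_mem measurableSet_Ioi] with y hy
    have : 0 < y := hy
    positivity

/-- Euler's Beta integral on the half line. -/
theorem lintegral_rpow_mul_one_add_rpow {s a : ℝ} (hs : 0 < s) (hsa : s < a) :
    ∫⁻ t in Ioi (0 : ℝ), ENNReal.ofReal (t ^ (s - 1) * (1 + t) ^ (-a)) =
      ENNReal.ofReal (Real.Gamma s * Real.Gamma (a - s) / Real.Gamma a) := by
  have hΓs := Real.Gamma_pos_of_pos hs
  have hΓa := Real.Gamma_pos_of_pos (hs.trans hsa)
  have h1 : ∀ t ∈ Ioi (0 : ℝ), ENNReal.ofReal (Real.Gamma a) *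
      ENNReal.ofReal (t ^ (s - 1) * (1 + t) ^ (-a)) =
      ∫⁻ y in Ioi (0 : ℝ), ENNReal.ofReal (t ^ (s - 1)) *
        ENNReal.ofReal (y ^ (a - 1) * Real.exp (-((1 + t) * y))) := by
    intro t ht
    have ht0 : 0 < t := ht
    rw [lintegral_const_mul _ (by fun_prop),
      lintegral_rpow_mul_exp_neg_mul (hs.trans hsa) (by linarith),
      ← ENNReal.ofReal_mul (by positivity), ← ENNReal.ofReal_mul (by positivity),
      one_div, Real.inv_rpow (by positivity), Real.rpow_neg (by positivity)]
    congr 1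
    ring
  have h2 : ∀ y ∈ Ioi (0 : ℝ), ∫⁻ t in Ioi (0 : ℝ), ENNReal.ofReal (t ^ (s - 1)) *
        ENNReal.ofReal (y ^ (a - 1) * Real.exp (-((1 + t) * y))) =
      ENNReal.ofReal (Real.Gamma s) *
        ENNReal.ofReal (y ^ (a - s - 1) * Real.exp (-(1 * y))) := by
    intro y hy
    have hy0 : 0 < y := hy
    have h3 : ∀ t ∈ Ioi (0 : ℝ), ENNReal.ofReal (t ^ (s - 1)) *
        ENNReal.ofReal (y ^ (a - 1) * Real.exp (-((1 + t) * y))) =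
        ENNReal.ofReal (y ^ (a - 1) * Real.exp (-y)) *
          ENNReal.ofReal (t ^ (s - 1) * Real.exp (-(y * t))) := by
      intro t ht
      have ht0 : 0 < t := ht
      rw [← ENNReal.ofReal_mul (by positivity), ← ENNReal.ofReal_mul (by positivity),
        show -((1 + t) * y) = -y + -(y * t) by ring, Real.exp_add]
      congr 1
      ring
    rw [setLIntegral_congr_fun measurableSet_Ioi h3, lintegral_const_mul _ (by fun_prop),
      lintegral_rpow_mul_exp_neg_mul hs hy0, ← ENNReal.ofReal_mul (by positivity),
      ← ENNReal.ofReal_mul (by positivity), one_div, Real.inv_rpow hy0.le,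
      show a - s - 1 = a - 1 - s by ring, Real.rpow_sub hy0 (a - 1) s, one_mul]
    congr 1
    ring
  have h0 : ENNReal.ofReal (Real.Gamma a) ≠ 0 := by simpa using hΓa
  refine (ENNReal.mul_right_inj h0 ENNReal.ofReal_ne_top).1 ?_
  rw [← lintegral_const_mul _ (by fun_prop), setLIntegral_congr_fun measurableSet_Ioi h1,
    lintegral_lintegral_swap (by fun_prop), setLIntegral_congr_fun measurableSet_Ioi h2,
    lintegral_const_mul _ (by fun_prop),
    lintegral_rpow_mul_exp_neg_mul (sub_pos.2 hsa) one_pos, ← ENNReal.ofReal_mul hΓs.le,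
    ← ENNReal.ofReal_mul hΓa.le]
  congr 1
  rw [one_div_one, Real.one_rpow]
  field_simp

section InnerProduct

variable {E : Type*} [NormedAddCommGroup E] [InnerProductSpace ℝ E]
    [MeasurableSpace E] [BorelSpace E] [FiniteDimensional ℝ E] [Nontrivial E]

theorem lintegral_ball_inner_sq_eq_mul_toSphere (v : E) :
    ∫⁻ w in ball (0 : E) 1, ENNReal.ofReal (inner ℝ w v ^ 2) =
      ENNReal.ofReal (1 / (Module.finrank ℝ E + 2)) *
        ∫⁻ ω, ENNReal.ofReal (inner ℝ ω.1 v ^ 2) ∂(volume : Measure E).toSphere := by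
  have hd : 0 < Module.finrank ℝ E := Module.finrank_pos
  rw [← lintegral_indicator measurableSet_ball, lintegral_eq_lintegral_toSphere _
    ((by fun_prop : Measurable fun w : E ↦ ENNReal.ofReal (inner ℝ w v ^ 2)).indicator
      measurableSet_ball), ← lintegral_const_mul _ (by fun_prop)]
  refine lintegral_congr fun ω ↦ ?_
  have key : ∀ r ∈ Ioi (0 : ℝ), ENNReal.ofReal (r ^ (Module.finrank ℝ E - 1)) *
      (ball (0 : E) 1).indicator (fun w ↦ ENNReal.ofReal (inner ℝ w v ^ 2)) (r • ω.1) =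
      (Ioo 0 1).indicator (fun r ↦ ENNReal.ofReal (r ^ (Module.finrank ℝ E + 1)) *
        ENNReal.ofReal (inner ℝ ω.1 v ^ 2)) r := by
    intro r hr
    have hr' : 0 < r := hr
    have hm : r • ω.1 ∈ ball (0 : E) 1 ↔ r ∈ Ioo (0 : ℝ) 1 := by
      simp [norm_smul, abs_of_pos hr', hr']
    by_cases h : r ∈ Ioo (0 : ℝ) 1
    · rw [indicator_of_mem h, indicator_of_mem (hm.2 h), ← ENNReal.ofReal_mul (by positivity),
        ← ENNReal.ofReal_mul (by positivity), inner_smul_left]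
      congr 1
      obtain ⟨k, hk⟩ : ∃ k, Module.finrank ℝ E = k + 1 := ⟨_, (Nat.sub_add_cancel hd).symm⟩
      simp only [hk, Nat.add_sub_cancel, conj_trivial]
      ring
    · rw [indicator_of_notMem h, indicator_of_notMem (mt hm.1 h), mul_zero]
  rw [setLIntegral_congr_fun measurableSet_Ioi key, lintegral_indicator measurableSet_Ioo,
    restrict_restrict measurableSet_Ioo, inter_eq_self_of_subset_left Ioo_subset_Ioi_self,
    lintegral_mul_const _ (by fun_prop), lintegral_ofReal_Ioo_pow zero_le_one]
  congr 2
  push_cast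
  rw [one_pow]; ring

omit [Nontrivial E] in
theorem lintegral_ball_inner_sq_congr {v w : E} (h : ‖v‖ = ‖w‖) :
    ∫⁻ z in ball (0 : E) 1, ENNReal.ofReal (inner ℝ z v ^ 2) =
      ∫⁻ z in ball (0 : E) 1, ENNReal.ofReal (inner ℝ z w ^ 2) := by
  set T := (ℝ ∙ (v - w))ᗮ.reflection
  have hT : T v = w := Submodule.reflection_sub h
  rw [← T.measurePreserving.setLIntegral_comp_preimage_emb
    T.toHomeomorph.measurableEmbedding (fun z ↦ ENNReal.ofReal (inner ℝ z w ^ 2)) (ball 0 1)]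
  simp [← hT]

theorem lintegral_toSphere_inner_sq (v : E) :
    ∫⁻ ω, ENNReal.ofReal (inner ℝ ω.1 v ^ 2) ∂(volume : Measure E).toSphere =
      ENNReal.ofReal (‖v‖ ^ 2 / Module.finrank ℝ E) * (volume : Measure E).toSphere univ := by
  have hd : 0 < Module.finrank ℝ E := Module.finrank_pos
  set b := stdOrthonormalBasis ℝ E
  have hM : ∀ i, ∫⁻ ω, ENNReal.ofReal (inner ℝ ω.1 (‖v‖ • b i) ^ 2)
      ∂(volume : Measure E).toSphere =
      ∫⁻ ω, ENNReal.ofReal (inner ℝ ω.1 v ^ 2) ∂(volume : Measure E).toSphere := by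
    intro i
    have h := lintegral_ball_inner_sq_congr (v := ‖v‖ • b i) (w := v) (by simp [norm_smul])
    rw [lintegral_ball_inner_sq_eq_mul_toSphere, lintegral_ball_inner_sq_eq_mul_toSphere] at h
    exact (ENNReal.mul_right_inj (by positivity) ENNReal.ofReal_ne_top).1 h
  have hsum : ∑ i, ∫⁻ ω, ENNReal.ofReal (inner ℝ ω.1 (‖v‖ • b i) ^ 2)
      ∂(volume : Measure E).toSphere =
      ENNReal.ofReal (‖v‖ ^ 2) * (volume : Measure E).toSphere univ := by
    rw [← lintegral_finsetSum _ (by fun_prop), ← lintegral_const]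
    refine lintegral_congr fun ω ↦ ?_
    rw [← ENNReal.ofReal_sum_of_nonneg (fun _ _ ↦ sq_nonneg _)]
    congr 1
    simp only [inner_smul_right, mul_pow, ← Finset.mul_sum]
    have := b.sum_sq_norm_inner_left ω.1
    simp only [Real.norm_eq_abs, sq_abs] at this
    simp [this]
  simp only [hM, Finset.sum_const, Finset.card_univ, Fintype.card_fin, nsmul_eq_mul] at hsum
  have hd0 : (Module.finrank ℝ E : ℝ≥0∞) ≠ 0 := by simpa using hd.ne'
  refine (ENNReal.mul_right_inj hd0 (ENNReal.natCast_ne_top _)).1 ?_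
  rw [hsum, ← mul_assoc, ← ENNReal.ofReal_natCast, ← ENNReal.ofReal_mul (by positivity)]
  congr 2
  field_simp

omit [MeasurableSpace E] [BorelSpace E] [FiniteDimensional ℝ E] [Nontrivial E] in
theorem norm_smul_add_lt_iff {ω v : E} {r R : ℝ} (hω : ‖ω‖ = 1) (hv : ‖v‖ < R) (hr : 0 < r) :
    ‖r • ω + v‖ < R ↔ r < √(inner ℝ ω v ^ 2 + R ^ 2 - ‖v‖ ^ 2) - inner ℝ ω v := by
  have hR : 0 < R := (norm_nonneg v).trans_lt hv
  have hv2 : ‖v‖ ^ 2 < R ^ 2 := by gcongr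
  set p := inner ℝ ω v
  have h1 : ‖r • ω + v‖ ^ 2 = r ^ 2 + 2 * r * p + ‖v‖ ^ 2 := by
    rw [norm_add_sq_real, norm_smul, inner_smul_left, hω]
    simp [p]; ring
  have hp : |p| < √(p ^ 2 + R ^ 2 - ‖v‖ ^ 2) := by
    rw [← Real.sqrt_sq_eq_abs]
    exact Real.sqrt_lt_sqrt (sq_nonneg _) (by linarith)
  rw [← sq_lt_sq₀ (norm_nonneg _) hR.le, h1, lt_sub_iff_add_lt]
  have h2 : -√(p ^ 2 + R ^ 2 - ‖v‖ ^ 2) < r + p := by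
    have := neg_abs_le p
    linarith
  have h3 : (r + p) ^ 2 < p ^ 2 + R ^ 2 - ‖v‖ ^ 2 ↔ r + p < √(p ^ 2 + R ^ 2 - ‖v‖ ^ 2) := by
    rw [Real.sq_lt, and_iff_right h2]
  rw [← h3]
  constructor <;> intro h <;> linarith

omit [MeasurableSpace E] [BorelSpace E] in
theorem lintegral_ray_ball {ω v : E} {R : ℝ} (hω : ‖ω‖ = 1) (hv : ‖v‖ < R) :
    ∫⁻ r in Ioi (0 : ℝ), ENNReal.ofReal (r ^ (Module.finrank ℝ E - 1)) *
      {w : E | ‖w + v‖ < R}.indicator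
        (fun w ↦ ENNReal.ofReal (‖w‖ ^ (2 - Module.finrank ℝ E : ℝ))) (r • ω) =
    ENNReal.ofReal ((√(inner ℝ ω v ^ 2 + R ^ 2 - ‖v‖ ^ 2) - inner ℝ ω v) ^ 2 / 2) := by
  have hd : 0 < Module.finrank ℝ E := Module.finrank_pos
  set ρ := √(inner ℝ ω v ^ 2 + R ^ 2 - ‖v‖ ^ 2) - inner ℝ ω v with hρ
  have hρ0 : 0 ≤ ρ := by
    have hv2 : ‖v‖ ^ 2 ≤ R ^ 2 := by gcongr
    have := Real.abs_le_sqrt (x := inner ℝ ω v)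
      (y := inner ℝ ω v ^ 2 + R ^ 2 - ‖v‖ ^ 2) (by linarith)
    linarith [le_abs_self (inner ℝ ω v)]
  have key : ∀ r ∈ Ioi (0 : ℝ), ENNReal.ofReal (r ^ (Module.finrank ℝ E - 1)) *
      {w : E | ‖w + v‖ < R}.indicator
        (fun w ↦ ENNReal.ofReal (‖w‖ ^ (2 - Module.finrank ℝ E : ℝ))) (r • ω) =
      (Ioo 0 ρ).indicator (fun r ↦ ENNReal.ofReal (r ^ 1)) r := by
    intro r hr
    have hr' : 0 < r := hr
    have hm : r • ω ∈ {w : E | ‖w + v‖ < R} ↔ r ∈ Ioo 0 ρ := by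
      simp [norm_smul_add_lt_iff hω hv hr', hr', hρ]
    by_cases h : r ∈ Ioo (0 : ℝ) ρ
    · rw [indicator_of_mem h, indicator_of_mem (hm.2 h), ← ENNReal.ofReal_mul (by positivity),
        norm_smul, hω, Real.norm_of_nonneg hr'.le, mul_one, ← Real.rpow_natCast,
        ← Real.rpow_natCast, ← Real.rpow_add hr', Nat.cast_sub hd]
      congr 2
      push_cast
      ring
    · rw [indicator_of_notMem h, indicator_of_notMem (mt hm.1 h), mul_zero]
  rw [setLIntegral_congr_fun measurableSet_Ioi key, lintegral_indicator measurableSet_Ioo,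
    restrict_restrict measurableSet_Ioo, inter_eq_self_of_subset_left Ioo_subset_Ioi_self,
    lintegral_ofReal_Ioo_pow hρ0]
  norm_num

/-- Newton's formula for the (suitably normalised) potential of a ball at an interior point. -/
theorem lintegral_ball_norm_sub_rpow {x c : E} {R : ℝ} (h : ‖x - c‖ < R) :
    ∫⁻ z in ball c R, ENNReal.ofReal (‖x - z‖ ^ (2 - Module.finrank ℝ E : ℝ)) =
      ENNReal.ofReal (‖x - c‖ ^ 2 / Module.finrank ℝ E + (R ^ 2 - ‖x - c‖ ^ 2) / 2) *
        (volume : Measure E).toSphere univ := by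
  set v := x - c with hv
  set G : E → ℝ≥0∞ := {w : E | ‖w + v‖ < R}.indicator
        (fun w ↦ ENNReal.ofReal (‖w‖ ^ (2 - Module.finrank ℝ E : ℝ))) with hG
  have hv2 : ‖v‖ ^ 2 ≤ R ^ 2 := by gcongr
  have hGm : Measurable G := by
    refine Measurable.indicator (by fun_prop) ?_
    exact measurableSet_lt (by fun_prop) (by fun_prop)
  have h1 : ∫⁻ z in ball c R, ENNReal.ofReal (‖x - z‖ ^ (2 - Module.finrank ℝ E : ℝ)) =
      ∫⁻ w, G w := by
    rw [← lintegral_indicator measurableSet_ball, ← lintegral_sub_right_eq_self G x]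
    refine lintegral_congr fun z ↦ ?_
    have : z ∈ ball c R ↔ z - x ∈ {w : E | ‖w + v‖ < R} := by
      simp [hv, dist_eq_norm]
    by_cases hz : z ∈ ball c R
    · rw [hG, indicator_of_mem hz, indicator_of_mem (this.1 hz), norm_sub_rev]
    · rw [hG, indicator_of_notMem hz, indicator_of_notMem (mt this.2 hz)]
  have h2 : 2 * ∫⁻ w, G w = ∫⁻ w, (G w + G (-w)) := by
    rw [lintegral_add_left hGm, lintegral_neg_eq_self G, two_mul]
  have h3 : ∫⁻ w, (G w + G (-w)) = ∫⁻ ω, (2 * ENNReal.ofReal (inner ℝ ω.1 v ^ 2) +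
      ENNReal.ofReal (R ^ 2 - ‖v‖ ^ 2)) ∂(volume : Measure E).toSphere := by
    rw [lintegral_eq_lintegral_toSphere _ (by fun_prop)]
    refine lintegral_congr fun ω ↦ ?_
    have hω : ‖ω.1‖ = 1 := by simp
    simp only [mul_add]
    rw [lintegral_add_left (by fun_prop)]
    simp only [← smul_neg]
    rw [hG, lintegral_ray_ball hω h, lintegral_ray_ball (by simp) h,
      ← ENNReal.ofReal_add (by positivity) (by positivity),
      ← ENNReal.ofReal_ofNat 2, ← ENNReal.ofReal_mul (by positivity),
      ← ENNReal.ofReal_add (by positivity) (by linarith)]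
    congr 1
    rw [inner_neg_left, neg_sq]
    have := Real.sq_sqrt (x := inner ℝ ω.1 v ^ 2 + R ^ 2 - ‖v‖ ^ 2)
      (by linarith [sq_nonneg (inner ℝ ω.1 v)])
    linarith
  rw [lintegral_add_right _ measurable_const, lintegral_const,
    lintegral_const_mul _ (by fun_prop), lintegral_toSphere_inner_sq, ← mul_assoc, ← add_mul,
    ← ENNReal.ofReal_ofNat 2, ← ENNReal.ofReal_mul (by positivity),
      ← ENNReal.ofReal_add (by positivity) (by linarith)] at h3
  rw [h1]
  refine (ENNReal.mul_right_inj (a := 2) (by simp) (by simp)).1 ?_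
  rw [h2, h3, ← mul_assoc, ← ENNReal.ofReal_ofNat 2, ← ENNReal.ofReal_mul (by positivity)]
  congr 2
  ring

omit [MeasurableSpace E] [BorelSpace E] [FiniteDimensional ℝ E] [Nontrivial E] in
theorem lt_max_div_iff_mem_ball {x z : E} {t : ℝ} (ht : 0 < t) (hx : ‖x‖ < 1) :
    t < max (1 - ‖z‖ ^ 2) 0 / ‖x - z‖ ^ 2 ↔
      z ∈ ball ((t / (1 + t)) • x) (√(1 / (1 + t) - t * ‖x‖ ^ 2 / (1 + t) ^ 2)) \ {x} := by
  by_cases hzx : z = x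
  · subst hzx
    simp [ht.le]
  have hpos : 0 < ‖x - z‖ ^ 2 := by
    have : 0 < ‖x - z‖ := norm_pos_iff.2 (sub_ne_zero.2 (Ne.symm hzx))
    positivity
  have ht1 : 0 < 1 + t := by linarith
  rw [lt_div_iff₀ hpos, lt_max_iff, mem_sdiff, and_iff_left (by simpa using hzx),
    or_iff_left (not_lt.2 (by positivity)), mem_ball, dist_eq_norm,
    Real.lt_sqrt (norm_nonneg _), norm_sub_sq_real, norm_sub_sq_real, inner_smul_right, norm_smul,
    Real.norm_of_nonneg (by positivity), real_inner_comm z x]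
  have key : 1 / (1 + t) - t * ‖x‖ ^ 2 / (1 + t) ^ 2 -
      (‖z‖ ^ 2 - 2 * (t / (1 + t) * inner ℝ z x) + (t / (1 + t) * ‖x‖) ^ 2) =
      (1 + t)⁻¹ * (1 - ‖z‖ ^ 2 - t * (‖x‖ ^ 2 - 2 * inner ℝ z x + ‖z‖ ^ 2)) := by
    field_simp
    ring
  rw [← sub_pos, ← sub_pos (b := ‖z‖ ^ 2 - _ + _), key]
  simp [ht1]

theorem setLIntegral_lt_max_div {x : E} (hx : ‖x‖ < 1) {t : ℝ} (ht : 0 < t) :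
    ∫⁻ z in {z | t < max (1 - ‖z‖ ^ 2) 0 / ‖x - z‖ ^ 2},
      ENNReal.ofReal (‖x - z‖ ^ (2 - Module.finrank ℝ E : ℝ)) =
    ENNReal.ofReal ((1 - ‖x‖ ^ 2) / 2 * (1 + t) ^ (-1 : ℝ) +
      ‖x‖ ^ 2 / Module.finrank ℝ E * (1 + t) ^ (-2 : ℝ)) *
      (volume : Measure E).toSphere univ := by
  have ht1 : 0 < 1 + t := by linarith
  have hd : 0 < (Module.finrank ℝ E : ℝ) := by exact_mod_cast Module.finrank_pos
  have hset : {z | t < max (1 - ‖z‖ ^ 2) 0 / ‖x - z‖ ^ 2} =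
      ball ((t / (1 + t)) • x) (√(1 / (1 + t) - t * ‖x‖ ^ 2 / (1 + t) ^ 2)) \ {x} := by
    ext z
    exact lt_max_div_iff_mem_ball ht hx
  have hx2 : ‖x‖ ^ 2 < 1 := by
    have := norm_nonneg x
    nlinarith
  have hsub : x - (t / (1 + t)) • x = (1 / (1 + t)) • x := by
    nth_rw 1 [← one_smul ℝ x]
    rw [← sub_smul]
    congr 1
    field_simp
    ring
  have hR : 1 / (1 + t) - t * ‖x‖ ^ 2 / (1 + t) ^ 2 - ‖x - (t / (1 + t)) • x‖ ^ 2 =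
      (1 - ‖x‖ ^ 2) / (1 + t) := by
    rw [hsub, norm_smul, Real.norm_of_nonneg (by positivity)]
    field_simp
    ring
  have hRpos : 0 < (1 - ‖x‖ ^ 2) / (1 + t) := div_pos (by linarith) ht1
  rw [hset, setLIntegral_congr (sdiff_null_ae_eq_self (measure_singleton x)),
    lintegral_ball_norm_sub_rpow]
  · congr 2
    rw [Real.sq_sqrt (by linarith [sq_nonneg ‖x - (t / (1 + t)) • x‖]), hR, hsub, norm_smul,
      Real.norm_of_nonneg (by positivity), Real.rpow_neg_one, Real.rpow_neg ht1.le,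
      Real.rpow_two]
    field_simp
    ring
  · rw [Real.lt_sqrt (norm_nonneg _)]
    linarith

theorem lintegral_max_rpow_mul_norm_sub_rpow {s : ℝ} (hs0 : 0 < s) (hs1 : s < 1)
    (hsd : 2 - 2 * s < Module.finrank ℝ E) {x : E} (hx : ‖x‖ < 1) :
    ∫⁻ z, ENNReal.ofReal (max (1 - ‖z‖ ^ 2) 0 ^ s *
      ‖x - z‖ ^ (2 - 2 * s - Module.finrank ℝ E)) =
    ENNReal.ofReal (Real.Gamma (1 + s) * Real.Gamma (1 - s) *
      ((1 - ‖x‖ ^ 2) / 2 + (1 - s) * ‖x‖ ^ 2 / Module.finrank ℝ E)) *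
      (volume : Measure E).toSphere univ := by
  have hd : 0 < (Module.finrank ℝ E : ℝ) := by exact_mod_cast Module.finrank_pos
  have hx2 : 0 < 1 - ‖x‖ ^ 2 := by
    have := norm_nonneg x
    nlinarith
  have hΓ := Real.Gamma_pos_of_pos (s := 1 - s) (by linarith)
  have hΓ' := Real.Gamma_pos_of_pos hs0
  set k : E → ℝ≥0∞ := fun z ↦ ENNReal.ofReal (‖x - z‖ ^ (2 - Module.finrank ℝ E : ℝ)) with hk
  set f : E → ℝ := fun z ↦ max (1 - ‖z‖ ^ 2) 0 / ‖x - z‖ ^ 2 with hf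
  have hkm : Measurable k := by fun_prop
  have hfm : Measurable f := by fun_prop
  have hpt : ∀ z, ENNReal.ofReal (max (1 - ‖z‖ ^ 2) 0 ^ s *
      ‖x - z‖ ^ (2 - 2 * s - Module.finrank ℝ E)) =
      (k * fun z ↦ ENNReal.ofReal (f z ^ s)) z := by
    intro z
    rw [Pi.mul_apply, hk, hf, ← ENNReal.ofReal_mul (by positivity)]
    congr 1
    rcases eq_or_ne z x with rfl | hzx
    · simp [Real.zero_rpow hs0.ne', Real.zero_rpow (sub_neg.2 hsd).ne]
    · have : 0 < ‖x - z‖ := norm_pos_iff.2 (sub_ne_zero.2 hzx.symm)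
      rw [Real.div_rpow (by positivity) (by positivity), ← Real.rpow_natCast_mul this.le,
        mul_div_assoc', div_eq_mul_inv, ← Real.rpow_neg this.le, mul_right_comm,
        ← Real.rpow_add this, mul_comm]
      congr 2
      push_cast
      ring
  have hmeas : ∀ t ∈ Ioi (0 : ℝ), (volume.withDensity k) {z | t < f z} *
      ENNReal.ofReal (t ^ (s - 1)) =
      (volume : Measure E).toSphere univ * (
      ENNReal.ofReal ((1 - ‖x‖ ^ 2) / 2) *
        ENNReal.ofReal (t ^ (s - 1) * (1 + t) ^ (-1 : ℝ)) +
      ENNReal.ofReal (‖x‖ ^ 2 / Module.finrank ℝ E) *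
        ENNReal.ofReal (t ^ (s - 1) * (1 + t) ^ (-2 : ℝ))) := by
    intro t ht
    have ht0 : 0 < t := ht
    rw [withDensity_apply _ (measurableSet_lt measurable_const hfm),
      setLIntegral_lt_max_div hx ht, mul_comm (ENNReal.ofReal _) (toSphere _ _), mul_assoc,
      ← ENNReal.ofReal_mul (by positivity), ← ENNReal.ofReal_mul (by positivity),
      ← ENNReal.ofReal_mul (by positivity), ← ENNReal.ofReal_add (by positivity) (by positivity)]
    congr 2
    ring
  rw [lintegral_congr hpt, ← lintegral_withDensity_eq_lintegral_mul _ hkm (by fun_prop),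
    lintegral_rpow_eq_lintegral_meas_lt_mul _ (.of_forall fun z ↦ by positivity) hfm.aemeasurable
      hs0, setLIntegral_congr_fun measurableSet_Ioi hmeas, lintegral_const_mul _ (by fun_prop),
    lintegral_add_left (by fun_prop), lintegral_const_mul _ (by fun_prop),
    lintegral_const_mul _ (by fun_prop), lintegral_rpow_mul_one_add_rpow hs0 hs1,
    lintegral_rpow_mul_one_add_rpow hs0 (by linarith), mul_left_comm, mul_comm (toSphere _ _),
    ← ENNReal.ofReal_mul (by positivity), ← ENNReal.ofReal_mul (by positivity),
    ← ENNReal.ofReal_add, ← ENNReal.ofReal_mul (by positivity)]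
  · congr 2
    rw [add_comm 1 s, Real.Gamma_add_one hs0.ne', show 2 - s = 1 - s + 1 by ring,
      Real.Gamma_add_one (by linarith), Real.Gamma_one, Real.Gamma_two]
    ring
  · rw [Real.Gamma_one]
    positivity
  · have := Real.Gamma_pos_of_pos (s := 2 - s) (by linarith)
    rw [Real.Gamma_two]
    positivity

end InnerProduct

theorem rieszPotential_max_rpow_eq {d : ℕ} (hd : 1 ≤ d) {α : ℝ} (hα : α ∈ Set.Ioo (0 : ℝ) 2)
    (hαd : 2 - α < d) {x : EuclideanSpace ℝ (Fin d)} (hx : ‖x‖ < 1) :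
    rieszPotential d (2 - α) (fun z => (max (1 - ‖z‖ ^ 2) 0) ^ (α / 2)) x =
      2 ^ α * Real.Gamma (1 + α / 2) * Real.Gamma (((d : ℝ) + α) / 2) / Real.Gamma ((d : ℝ) / 2) *
        (1 / (2 * (d - 2 + α)) - ‖x‖ ^ 2 / (2 * d)) := by
  obtain ⟨hα0, hα2⟩ := hα
  have hfr : Module.finrank ℝ (EuclideanSpace ℝ (Fin d)) = d := finrank_euclideanSpace_fin
  have : Nontrivial (EuclideanSpace ℝ (Fin d)) :=
    Module.nontrivial_of_finrank_pos (R := ℝ) (by omega)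
  have : Nonempty (Fin d) := ⟨⟨0, hd⟩⟩
  have hd0 : (0 : ℝ) < d := by exact_mod_cast hd
  have hx2 : 0 ≤ 1 - ‖x‖ ^ 2 := by
    have := norm_nonneg x
    nlinarith
  have hΓ1 := Real.Gamma_pos_of_pos (s := 1 + α / 2) (by linarith)
  have hΓ2 := Real.Gamma_pos_of_pos (s := 1 - α / 2) (by linarith)
  have hΓ3 := Real.Gamma_pos_of_pos (s := (d : ℝ) / 2) (by linarith)
  have hΓ4 := Real.Gamma_pos_of_pos (s := ((d : ℝ) - (2 - α)) / 2) (by linarith)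
  have hΓ5 : Real.Gamma (((d : ℝ) + α) / 2) =
      ((d : ℝ) - (2 - α)) / 2 * Real.Gamma (((d : ℝ) - (2 - α)) / 2) := by
    rw [← Real.Gamma_add_one (by linarith)]
    congr 1
    ring
  have hσ : ((volume : Measure (EuclideanSpace ℝ (Fin d))).toSphere univ).toReal =
      d * (π ^ ((d : ℝ) / 2) / (d / 2 * Real.Gamma ((d : ℝ) / 2))) := by
    rw [toSphere_apply_univ, hfr, EuclideanSpace.volume_ball, Fintype.card_fin,
      Real.Gamma_add_one (by positivity), Real.sqrt_eq_rpow, ← Real.rpow_mul_natCast pi_pos.le]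
    simp only [ENNReal.ofReal_one, one_pow, one_mul, ENNReal.toReal_mul, ENNReal.toReal_natCast]
    rw [ENNReal.toReal_ofReal (by positivity), one_div_mul_eq_div]
  have hint := lintegral_max_rpow_mul_norm_sub_rpow (s := α / 2) (by linarith) (by linarith)
    (by rw [hfr]; linarith) hx
  rw [hfr, mul_div_cancel₀ α two_ne_zero] at hint
  have hnn : 0 ≤ (1 - ‖x‖ ^ 2) / 2 + (1 - α / 2) * ‖x‖ ^ 2 / d :=
    add_nonneg (by positivity) (div_nonneg (mul_nonneg (by linarith) (sq_nonneg _)) hd0.le)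
  rw [rieszPotential, integral_eq_lintegral_of_nonneg_ae (.of_forall fun z ↦ by positivity)
    (by fun_prop), hint, ENNReal.toReal_mul, ENNReal.toReal_ofReal (by positivity), hσ, hΓ5,
    show (2 - α) / 2 = 1 - α / 2 by ring, Real.rpow_sub two_pos, Real.rpow_two]
  have : (d : ℝ) - 2 + α ≠ 0 := by linarith
  field_simp
  ring

theorem hasGradientAt_const_add_mul_norm_sq {E : Type*} [NormedAddCommGroup E]
    [InnerProductSpace ℝ E] [CompleteSpace E] (a b : ℝ) (y : E) :
    HasGradientAt (fun x ↦ a + b * ‖x‖ ^ 2) ((2 * b) • y) y := by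
  rw [hasGradientAt_iff_hasFDerivAt]
  refine (((hasStrictFDerivAt_norm_sq y).hasFDerivAt.const_mul b).const_add a).congr_fderiv ?_
  ext z
  simp
  ring

end Potential

theorem gradient_riesz_potential_phi_alpha_inside_ball
    (d : ℕ) (hd : 1 ≤ d) (α : ℝ) (hα : α ∈ Set.Ioo (0 : ℝ) 2) (hαd : 2 - α < d)
    (K : ℝ)
    (hK : K = Real.Gamma ((d : ℝ) / 2) /
        (2 ^ α * Real.Gamma (1 + α / 2) * Real.Gamma (((d : ℝ) + α) / 2)))
    (y : EuclideanSpace ℝ (Fin d)) (hy : ‖y‖ < 1) :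
    HasGradientAt
      (rieszPotential d (2 - α) (fun z => (max (1 - ‖z‖ ^ 2) 0) ^ (α / 2)))
      ((-(1 / ((d : ℝ) * K))) • y) y := by
  have hd0 : (0 : ℝ) < d := by exact_mod_cast hd
  set c := 2 ^ α * Real.Gamma (1 + α / 2) * Real.Gamma (((d : ℝ) + α) / 2) /
    Real.Gamma ((d : ℝ) / 2) with hc
  have hcoef : -(1 / ((d : ℝ) * K)) = 2 * -(c / (2 * d)) := by
    have hcK : c = 1 / K := by rw [hc, hK, one_div_div]
    rw [hcK, ← div_div, div_right_comm]
    ring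
  rw [hcoef]
  refine (hasGradientAt_const_add_mul_norm_sq (c / (2 * (d - 2 + α))) _ y).congr_of_eventuallyEq ?_
  filter_upwards [Metric.isOpen_ball.mem_nhds (mem_ball_zero_iff.2 hy)] with x hx
  rw [rieszPotential_max_rpow_eq hd hα hαd (mem_ball_zero_iff.1 hx)]
  ring
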